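/- Let ν = ν₁ × ⋯ × ν_m be a product of finite measures on [−1,1]^m and let g(t₁,…,t_m) = Σ_{a ∈ ℤ₊^m} c_a t^a be an absolutely and uniformly convergent series on [−1,1]^m with complex coefficients. Suppose there exist 0 ≤ θ₁,…,θ_m < 2π/3 such that for each i, Σ_{a: i ∈ supp a} |c_a| ∏_{j ∈ supp a} (1/cos(θ_j/2)) ≤ θ_i/2. Then |∫_{[−1,1]^m} e^g dν| ≥ (∏_{i=1}^m cos(θ_i/2)) · ∫_{[−1,1]^m} |e^g| dν. -/

import Mathlib

open MeasureTheory

theorem measurePreserving_update {ι : Type*} [Fintype ι] [DecidableEq ι] {X : ι → Type*}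
    [∀ i, MeasurableSpace (X i)] (μ : ∀ i, Measure (X i)) [∀ i, IsProbabilityMeasure (μ i)]
    (k : ι) :
    MeasurePreserving (fun p : X k × (∀ i, X i) => Function.update p.2 k p.1)
      ((μ k).prod (Measure.pi μ)) (Measure.pi μ) := by
  have hm : Measurable (fun p : X k × (∀ i, X i) => Function.update p.2 k p.1) := by
    refine measurable_pi_iff.2 fun i => ?_
    by_cases hi : i = k
    · subst hi
      simpa using measurable_fst
    · simp only [ne_eq, hi, not_false_eq_true, Function.update_of_ne]
      fun_prop
  refine ⟨hm, (Measure.pi_eq fun s hs => ?_).symm⟩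
  have hpre : (fun p : X k × (∀ i, X i) => Function.update p.2 k p.1) ⁻¹' Set.univ.pi s =
      s k ×ˢ Set.univ.pi (Function.update s k Set.univ) := by
    ext p
    simp only [Set.mem_preimage, Set.mem_pi, Set.mem_univ, true_imp_iff, Set.mem_prod]
    constructor
    · intro h
      refine ⟨by simpa using h k, fun i => ?_⟩
      by_cases hi : i = k
      · subst hi; simp
      · simpa [hi] using h i
    · rintro ⟨h1, h2⟩ i
      by_cases hi : i = k
      · subst hi; simpa using h1
      · simpa [hi] using h2 i
  rw [Measure.map_apply hm (MeasurableSet.univ_pi hs), hpre, Measure.prod_prod, Measure.pi_pi,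
    ← Finset.mul_prod_erase _ _ (Finset.mem_univ k),
    ← Finset.mul_prod_erase _ (fun i => μ i (s i)) (Finset.mem_univ k)]
  simp only [Function.update_self, measure_univ, one_mul]
  congr 1
  refine Finset.prod_congr rfl fun i hi => ?_
  rw [Function.update_of_ne (Finset.ne_of_mem_erase hi)]

theorem exists_eq_mul_exp_of_norm_deriv_le {G G' : ℝ → ℂ} {r : ℝ}
    (hG : ∀ x, HasDerivAt G (G' x) x) (hG' : Continuous G')
    (h0 : ∀ x ∈ Set.Icc (0 : ℝ) 1, G x ≠ 0)
    (hle : ∀ x ∈ Set.Icc (0 : ℝ) 1, ‖G' x‖ ≤ r * ‖G x‖) :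
    ∃ z : ℂ, G 1 = G 0 * Complex.exp z ∧ ‖z‖ ≤ r := by
  have hGc : Continuous G := continuous_iff_continuousAt.2 fun x => (hG x).continuousAt
  set p : ℝ → ℂ := Set.IccExtend zero_le_one ((Set.Icc (0 : ℝ) 1).domRestrict fun x => G' x / G x)
  have hpc : Continuous p := by
    apply Continuous.Icc_extend'
    exact continuousOn_iff_continuous_domRestrict.1 (hG'.continuousOn.div hGc.continuousOn h0)
  have hp : ∀ x ∈ Set.Icc (0 : ℝ) 1, p x = G' x / G x := fun x hx => by
    exact Set.IccExtend_of_mem _ _ hx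
  have hP : ∀ x, HasDerivAt (fun y => ∫ u in (0 : ℝ)..y, p u) (p x) x := fun x =>
    (hpc.integral_hasStrictDerivAt 0 x).hasDerivAt
  have hH : ∀ x, HasDerivAt (fun y => G y * Complex.exp (-∫ u in (0 : ℝ)..y, p u))
      (G' x * Complex.exp (-∫ u in (0 : ℝ)..x, p u) +
        G x * (Complex.exp (-∫ u in (0 : ℝ)..x, p u) * -p x)) x := fun x =>
    (hG x).mul (hP x).neg.cexp
  have hconst := constant_of_has_deriv_right_zero
    (f := fun y => G y * Complex.exp (-∫ u in (0 : ℝ)..y, p u)) (a := 0) (b := 1)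
    (fun x _ => (hH x).continuousAt.continuousWithinAt)
    (fun x hx => by
      have hx' := Set.Ico_subset_Icc_self hx
      convert (hH x).hasDerivWithinAt using 1
      rw [hp x hx']
      field_simp [h0 x hx']
      ring) 1 (by simp)
  refine ⟨∫ u in (0 : ℝ)..1, p u, ?_, ?_⟩
  · simp only [intervalIntegral.integral_same, neg_zero, Complex.exp_zero, mul_one] at hconst
    rw [← hconst, mul_assoc, ← Complex.exp_add]
    simp
  · have := intervalIntegral.norm_integral_le_of_norm_le_const (a := (0 : ℝ)) (b := 1) (f := p)
      (C := r) (fun x hx => by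
        rw [Set.uIoc_of_le zero_le_one] at hx
        have hx' := Set.Ioc_subset_Icc_self hx
        rw [hp x hx', norm_div]
        exact (div_le_iff₀ (norm_pos_iff.2 (h0 x hx'))).2 (hle x hx'))
    simpa using this

theorem cos_mul_integral_norm_le_norm_integral {Y : Type*} [MeasurableSpace Y] {μ : Measure Y}
    {F : Y → ℂ} (hF : Integrable F μ) {θ : ℝ} (hθ0 : 0 ≤ θ) (hθ : θ < 2 * Real.pi / 3)
    (hang : ∀ x y, ∃ z : ℂ, F y = F x * Complex.exp z ∧ |z.im| ≤ θ) :
    Real.cos (θ / 2) * ∫ x, ‖F x‖ ∂μ ≤ ‖∫ x, F x ∂μ‖ := by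
  rcases isEmpty_or_nonempty Y with hY | ⟨⟨x₀⟩⟩
  · simp [Measure.eq_zero_of_isEmpty μ]
  by_cases hx₀ : F x₀ = 0
  · have : F = 0 := funext fun y => by
      obtain ⟨z, hz, -⟩ := hang x₀ y
      simp [hz, hx₀]
    simp [this]
  choose z hz hzθ using hang x₀
  have hdiff : ∀ x y, (z y).im - (z x).im ≤ θ := fun x y => by
    obtain ⟨v, hv, hvθ⟩ := hang x y
    have hexp : Complex.exp (z y) = Complex.exp (z x + v) := by
      apply mul_left_cancel₀ hx₀
      rw [Complex.exp_add, ← mul_assoc, ← hz, ← hz, hv]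
    obtain ⟨n, hn⟩ := Complex.exp_eq_exp_iff_exists_int.1 hexp
    have him : (z y).im = (z x).im + v.im + n * (2 * Real.pi) := by
      simpa using congrArg Complex.im hn
    have h1 := abs_le.1 (hzθ x)
    have h2 := abs_le.1 (hzθ y)
    have h3 := abs_le.1 hvθ
    have hpi := Real.pi_pos
    have hn1 : n < 1 := by
      have : (n : ℝ) < 1 := by
        by_contra! h
        nlinarith
      exact_mod_cast this
    have hn2 : n ≤ 0 := by lia
    have : (n : ℝ) ≤ 0 := by exact_mod_cast hn2
    nlinarith
  have hbdd : BddAbove (Set.range fun x => (z x).im) :=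
    ⟨θ, by rintro _ ⟨x, rfl⟩; exact (abs_le.1 (hzθ x)).2⟩
  have : Nonempty Y := ⟨x₀⟩
  set A : ℝ := ⨆ x, (z x).im
  have hA1 : ∀ x, (z x).im ≤ A := fun x => le_ciSup hbdd x
  have hA2 : ∀ x, A - θ ≤ (z x).im := fun x => by
    have : A ≤ (z x).im + θ := ciSup_le fun y => by linarith [hdiff x y]
    linarith
  set u : ℂ := Complex.exp (-((A - θ / 2 : ℝ) * Complex.I)) * (‖F x₀‖ / F x₀)
  have hu : ‖u‖ = 1 := by
    have : ‖F x₀‖ ≠ 0 := norm_ne_zero_iff.2 hx₀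
    rw [norm_mul, ← neg_mul, ← Complex.ofReal_neg, Complex.norm_exp_ofReal_mul_I]
    simp [this]
  have key : ∀ x, Real.cos (θ / 2) * ‖F x‖ ≤ (u * F x).re := fun x => by
    have h1 : u * F x = ‖F x₀‖ * Complex.exp (z x - (A - θ / 2 : ℝ) * Complex.I) := by
      rw [hz x, sub_eq_neg_add, Complex.exp_add]
      simp only [u]
      field_simp
    have h2 : ‖F x‖ = ‖F x₀‖ * Real.exp (z x).re := by
      rw [hz x, norm_mul, Complex.norm_exp]
    have h3 : Real.cos (θ / 2) ≤ Real.cos ((z x).im - (A - θ / 2)) := by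
      rw [← Real.cos_abs ((z x).im - _)]
      have := Real.pi_pos
      apply Real.cos_le_cos_of_nonneg_of_le_pi (abs_nonneg _) (by linarith)
      exact abs_le.2 ⟨by linarith [hA2 x], by linarith [hA1 x]⟩
    have h4 : (u * F x).re = ‖F x₀‖ * Real.exp (z x).re * Real.cos ((z x).im - (A - θ / 2)) := by
      rw [h1, Complex.re_ofReal_mul, Complex.exp_re]
      simp [mul_assoc]
    rw [h4, h2, mul_comm]
    gcongr
  calc Real.cos (θ / 2) * ∫ x, ‖F x‖ ∂μ = ∫ x, Real.cos (θ / 2) * ‖F x‖ ∂μ :=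
        (integral_const_mul _ _).symm
    _ ≤ ∫ x, (u * F x).re ∂μ :=
        integral_mono (hF.norm.const_mul _) (hF.const_mul u).re key
    _ = (∫ x, u * F x ∂μ).re := integral_re (hF.const_mul u)
    _ ≤ ‖∫ x, u * F x ∂μ‖ := Complex.re_le_norm _
    _ = ‖∫ x, F x ∂μ‖ := by rw [integral_const_mul, norm_mul, hu, one_mul]

theorem integrable_mul_cexp {Y : Type*} [MeasurableSpace Y] {μ : Measure Y} [IsFiniteMeasure μ]
    {φ g : Y → ℂ} (hφ : Measurable φ) (hg : Measurable g) {C B : ℝ}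
    (hφC : ∀ y, ‖φ y‖ ≤ C) (hgB : ∀ y, ‖g y‖ ≤ B) :
    Integrable (fun y => φ y * Complex.exp (g y)) μ := by
  refine Integrable.of_bound (hφ.mul hg.cexp).aestronglyMeasurable (C * Real.exp B)
    (ae_of_all _ fun y => ?_)
  rw [norm_mul]
  have hC : 0 ≤ C := (norm_nonneg _).trans (hφC y)
  gcongr
  · exact hφC y
  · exact (Complex.norm_exp_le_exp_norm _).trans (Real.exp_le_exp.2 (hgB y))

theorem hasDerivAt_integral_mul_cexp {Y : Type*} [MeasurableSpace Y] {μ : Measure Y}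
    [IsFiniteMeasure μ] {φ g d : Y → ℂ} (hφ : Measurable φ) (hg : Measurable g)
    (hd : Measurable d) {C B D : ℝ} (hφC : ∀ y, ‖φ y‖ ≤ C) (hgB : ∀ y, ‖g y‖ ≤ B)
    (hdD : ∀ y, ‖d y‖ ≤ D) (x : ℝ) :
    HasDerivAt (fun τ : ℝ => ∫ y, φ y * Complex.exp (g y + τ * d y) ∂μ)
      (∫ y, φ y * d y * Complex.exp (g y + x * d y) ∂μ) x := by
  have hbd : ∀ τ : ℝ, ∀ y, ‖g y + τ * d y‖ ≤ B + |τ| * D := fun τ y =>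
    (norm_add_le _ _).trans <| by
      rw [norm_mul, Complex.norm_real, Real.norm_eq_abs]
      gcongr
      exacts [hgB y, hdD y]
  have hmeas : ∀ τ : ℝ, Measurable fun y => g y + τ * d y := fun τ => by fun_prop
  refine (hasDerivAt_integral_of_dominated_loc_of_deriv_le (μ := μ) (s := Metric.ball x 1)
    (F := fun (τ : ℝ) y => φ y * Complex.exp (g y + τ * d y))
    (F' := fun (τ : ℝ) y => φ y * d y * Complex.exp (g y + τ * d y))
    (bound := fun _ => C * D * Real.exp (B + (|x| + 1) * D))
    (Metric.ball_mem_nhds x one_pos) (.of_forall fun τ => ?_) ?_ ?_ (ae_of_all _ ?_)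
    (integrable_const _) (ae_of_all _ ?_)).2
  · exact (hφ.mul (hmeas τ).cexp).aestronglyMeasurable
  · exact integrable_mul_cexp hφ (hmeas x) hφC (hbd x)
  · exact ((hφ.mul hd).mul (hmeas x).cexp).aestronglyMeasurable
  · intro y τ hτ
    have hC : 0 ≤ C := (norm_nonneg _).trans (hφC y)
    have hD : 0 ≤ D := (norm_nonneg _).trans (hdD y)
    have hτ' : |τ| ≤ |x| + 1 := by
      have h1 : |τ - x| < 1 := hτ
      have h2 := abs_sub_abs_le_abs_sub τ x
      linarith
    rw [norm_mul, norm_mul]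
    gcongr
    · exact hφC y
    · exact hdD y
    · refine (Complex.norm_exp_le_exp_norm _).trans (Real.exp_le_exp.2 ((hbd τ y).trans ?_))
      gcongr
  · intro y τ _
    have h1 : HasDerivAt (fun τ : ℝ => g y + (τ : ℂ) * d y) (d y) τ := by
      simpa using ((Complex.ofRealCLM.hasDerivAt (x := τ)).mul_const (d y)).const_add (g y)
    exact (h1.cexp.const_mul (φ y)).congr_deriv (by ring)

/-- A family of measurable functions indexed by finite sets of coordinates, the `a`-th of which
is bounded by `w a` and depends only on the coordinates in `a ∩ N`. -/
structure IsLocalFamily {ι : Type*} [DecidableEq ι] {X : ι → Type*} [∀ i, MeasurableSpace (X i)]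
    (w : Finset ι → ℝ) (N : Finset ι) (h : Finset ι → (∀ i, X i) → ℂ) : Prop where
  measurable : ∀ a, Measurable (h a)
  norm_le : ∀ a t, ‖h a t‖ ≤ w a
  dependsOn : ∀ a, DependsOn (h a) ↑(a ∩ N)

section
variable {ι : Type*} [DecidableEq ι] {X : ι → Type*}

theorem DependsOn.comp_update {β : Type*} {f : (∀ i, X i) → β} {K : Finset ι}
    (hf : DependsOn f ↑K) (k : ι) (s : X k) :
    DependsOn (fun t => f (Function.update t k s)) ↑(K.erase k) := by
  intro x y hxy
  refine hf fun i hi => ?_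
  by_cases hik : i = k
  · subst hik; simp
  · simpa [hik] using hxy i (by simpa [hik] using hi)

variable [∀ i, MeasurableSpace (X i)]

theorem measurable_comp_update {f : (∀ i, X i) → ℂ} (hf : Measurable f) (k : ι) (s : X k) :
    Measurable fun t => f (Function.update t k s) :=
  hf.comp measurable_update_left

namespace IsLocalFamily
variable {w : Finset ι → ℝ} {N : Finset ι} {h : Finset ι → (∀ i, X i) → ℂ}

theorem update (hh : IsLocalFamily w N h) (k : ι) (s : X k) :
    IsLocalFamily w (N.erase k) fun a t => h a (Function.update t k s) where
  measurable a := measurable_comp_update (hh.measurable a) k s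
  norm_le a t := hh.norm_le a _
  dependsOn a := by
    rw [Finset.inter_erase]
    exact (hh.dependsOn a).comp_update k s

theorem interpolate {h' : Finset ι → (∀ i, X i) → ℂ} (hh : IsLocalFamily w N h)
    (hh' : IsLocalFamily w N h') {x : ℝ} (hx : x ∈ Set.Icc (0 : ℝ) 1) :
    IsLocalFamily w N fun a t => h a t + x * (h' a t - h a t) where
  measurable a := by
    have := hh.measurable a
    have := hh'.measurable a
    fun_prop
  norm_le a t := by
    have : h a t + x * (h' a t - h a t) = ((1 - x : ℝ) : ℂ) * h a t + (x : ℂ) * h' a t := by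
      push_cast; ring
    rw [this]
    refine (norm_add_le _ _).trans ?_
    rw [norm_mul, norm_mul, Complex.norm_of_nonneg hx.1,
      Complex.norm_of_nonneg (sub_nonneg.2 hx.2)]
    nlinarith [mul_le_mul_of_nonneg_left (hh.norm_le a t) (sub_nonneg.2 hx.2),
      mul_le_mul_of_nonneg_left (hh'.norm_le a t) hx.1]
  dependsOn a t t' ht := by
    simp only [hh.dependsOn a ht, hh'.dependsOn a ht]

theorem measurable_sum [Fintype ι] (hh : IsLocalFamily w N h) :
    Measurable fun t => ∑ a, h a t :=
  Finset.measurable_sum _ fun a _ => hh.measurable a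

theorem norm_sum_le [Fintype ι] (hh : IsLocalFamily w N h) (t : ∀ i, X i) :
    ‖∑ a, h a t‖ ≤ ∑ a, w a :=
  norm_sum_le_of_le _ fun a _ => hh.norm_le a t

theorem dependsOn_sum [Fintype ι] (hh : IsLocalFamily w N h) :
    DependsOn (fun t => ∑ a, h a t) ↑N := fun _ _ ht =>
  Finset.sum_congr rfl fun a _ => hh.dependsOn a fun i hi => ht i (Finset.mem_inter.1 hi).2

end IsLocalFamily
end

theorem cos_half_pos {x : ℝ} (h0 : 0 ≤ x) (h : x < 2 * Real.pi / 3) : 0 < Real.cos (x / 2) :=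
  Real.cos_pos_of_mem_Ioo ⟨by linarith [Real.pi_pos], by linarith [Real.pi_pos]⟩

section
variable {ι : Type*} [Fintype ι] {X : ι → Type*} [∀ i, MeasurableSpace (X i)]

/-- Inserting a factor `φ` that depends on the coordinates in `K` and is bounded by `W` increases
the modulus of `∫ exp g` by a factor of at most `W * ∏ j ∈ K, 1 / cos (θ j / 2)`. -/
def HasMomentBound (μ : ∀ i, Measure (X i)) (θ : ι → ℝ) (N : Finset ι) (g : (∀ i, X i) → ℂ) :
    Prop :=
  ∀ K ⊆ N, ∀ (φ : (∀ i, X i) → ℂ) (W : ℝ), Measurable φ → (∀ t, ‖φ t‖ ≤ W) → DependsOn φ ↑K →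
    ‖∫ t, φ t * Complex.exp (g t) ∂Measure.pi μ‖ ≤
      W * (∏ j ∈ K, (Real.cos (θ j / 2))⁻¹) * ‖∫ t, Complex.exp (g t) ∂Measure.pi μ‖

theorem HasMomentBound.integral_norm_le {μ : ∀ i, Measure (X i)} {θ : ι → ℝ} {N : Finset ι}
    {g : (∀ i, X i) → ℂ} (H : HasMomentBound μ θ N g) (hg : Measurable g)
    (hgN : DependsOn g ↑N) :
    ∫ t, ‖Complex.exp (g t)‖ ∂Measure.pi μ ≤
      (∏ j ∈ N, (Real.cos (θ j / 2))⁻¹) * ‖∫ t, Complex.exp (g t) ∂Measure.pi μ‖ := by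
  have h := H N subset_rfl (fun t => Complex.exp ((-(g t).im : ℝ) * Complex.I)) 1
    (by fun_prop) (fun t => (Complex.norm_exp_ofReal_mul_I _).le)
    (fun x y hxy => by simp only [hgN hxy])
  rw [one_mul] at h
  refine le_trans (le_of_eq ?_) h
  have : ∀ t, Complex.exp ((-(g t).im : ℝ) * Complex.I) * Complex.exp (g t) =
      (‖Complex.exp (g t)‖ : ℂ) := fun t => by
    rw [← Complex.exp_add, Complex.norm_exp, Complex.ofReal_exp]
    congr 1
    apply Complex.ext <;> simp
  simp_rw [this]
  rw [integral_complex_ofReal, Complex.norm_real, Real.norm_of_nonneg]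
  exact integral_nonneg fun _ => norm_nonneg _

theorem HasMomentBound.integral_ne_zero {μ : ∀ i, Measure (X i)} [∀ i, IsProbabilityMeasure (μ i)]
    {θ : ι → ℝ} {N : Finset ι} {g : (∀ i, X i) → ℂ} (H : HasMomentBound μ θ N g)
    (hg : Measurable g) (hgN : DependsOn g ↑N) {B : ℝ} (hgB : ∀ t, ‖g t‖ ≤ B) :
    ∫ t, Complex.exp (g t) ∂Measure.pi μ ≠ 0 := by
  intro h0
  have h := H.integral_norm_le hg hgN
  have hint : Integrable (fun t => Complex.exp (g t)) (Measure.pi μ) := by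
    simpa using integrable_mul_cexp (μ := Measure.pi μ) (φ := fun _ => 1) measurable_const hg
      (C := 1) (by simp) hgB
  have hint' := hint.norm
  simp_rw [Complex.norm_exp] at hint' h
  have := integral_exp_pos hint'
  rw [h0, norm_zero, mul_zero] at h
  linarith

variable [DecidableEq ι] {w : Finset ι → ℝ} {θ : ι → ℝ}

theorem exists_integral_cexp_update_eq {μ : ∀ i, Measure (X i)} [∀ i, IsProbabilityMeasure (μ i)]
    (hθ0 : ∀ i, 0 ≤ θ i) (hθ : ∀ i, θ i < 2 * Real.pi / 3)
    {N : Finset ι} {k : ι} (hw : ∑ a with k ∈ a, w a * ∏ j ∈ a, (Real.cos (θ j / 2))⁻¹ ≤ θ k / 2)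
    (H : ∀ h : Finset ι → (∀ i, X i) → ℂ, IsLocalFamily w (N.erase k) h →
      HasMomentBound μ θ (N.erase k) fun t => ∑ a, h a t)
    {h : Finset ι → (∀ i, X i) → ℂ} (hh : IsLocalFamily w N h) (hk : k ∈ N) (s s' : X k) :
    ∃ z : ℂ, ∫ t, Complex.exp (∑ a, h a (Function.update t k s')) ∂Measure.pi μ =
      (∫ t, Complex.exp (∑ a, h a (Function.update t k s)) ∂Measure.pi μ) * Complex.exp z ∧
      ‖z‖ ≤ θ k := by
  have hw0 : ∀ a, 0 ≤ w a := fun a => by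
    by_cases hX : Nonempty (∀ i, X i)
    · exact (norm_nonneg _).trans (hh.norm_le a hX.some)
    · have : IsEmpty (∀ i, X i) := not_nonempty_iff.1 hX
      exact absurd (measure_univ (μ := Measure.pi μ)) (by simp [Measure.eq_zero_of_isEmpty])
  set h₀ : Finset ι → (∀ i, X i) → ℂ := fun a t => h a (Function.update t k s)
  set h₁ : Finset ι → (∀ i, X i) → ℂ := fun a t => h a (Function.update t k s')
  have hh₀ : IsLocalFamily w (N.erase k) h₀ := hh.update k s
  have hh₁ : IsLocalFamily w (N.erase k) h₁ := hh.update k s'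
  set d : (∀ i, X i) → ℂ := fun t => ∑ a, h₁ a t - ∑ a, h₀ a t
  have hd : Measurable d := hh₁.measurable_sum.sub hh₀.measurable_sum
  have hdB : ∀ t, ‖d t‖ ≤ ∑ a, w a + ∑ a, w a := fun t =>
    (norm_sub_le _ _).trans (add_le_add (hh₁.norm_sum_le t) (hh₀.norm_sum_le t))
  have hexp : ∀ (x : ℝ) t, ∑ a, h₀ a t + x * d t = ∑ a, (h₀ a t + x * (h₁ a t - h₀ a t)) :=
    fun x t => by
      rw [Finset.sum_add_distrib, ← Finset.mul_sum, Finset.sum_sub_distrib]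
  have hder := hasDerivAt_integral_mul_cexp (μ := Measure.pi μ) (φ := fun _ => 1)
    measurable_const hh₀.measurable_sum hd (C := 1) (by simp) hh₀.norm_sum_le hdB
  have hder' := hasDerivAt_integral_mul_cexp (μ := Measure.pi μ) hd hh₀.measurable_sum hd hdB
    hh₀.norm_sum_le hdB
  simp only [one_mul] at hder
  have hfam := fun {x : ℝ} hx => hh₀.interpolate hh₁ (x := x) hx
  obtain ⟨z, hz, hzθ⟩ := exists_eq_mul_exp_of_norm_deriv_le (r := θ k) hder
    (continuous_iff_continuousAt.2 fun x => (hder' x).continuousAt)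
    (fun x hx => by
      simp_rw [hexp]
      exact (H _ (hfam hx)).integral_ne_zero (hfam hx).measurable_sum (hfam hx).dependsOn_sum
        (hfam hx).norm_sum_le)
    (fun x hx => by
      simp_rw [hexp]
      have hf := hfam hx
      set e : (∀ i, X i) → ℂ := fun t => ∑ a, (h₀ a t + x * (h₁ a t - h₀ a t))
      have hbound : ∀ a, ‖∫ t, (h₁ a t - h₀ a t) * Complex.exp (e t) ∂Measure.pi μ‖ ≤
          (if k ∈ a then 2 * (w a * ∏ j ∈ a, (Real.cos (θ j / 2))⁻¹) else 0) *
            ‖∫ t, Complex.exp (e t) ∂Measure.pi μ‖ := fun a => by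
        split_ifs with ha
        · refine (H _ hf (a ∩ N.erase k) Finset.inter_subset_right _ (w a + w a)
            ((hh₁.measurable a).sub (hh₀.measurable a))
            (fun t => (norm_sub_le _ _).trans (add_le_add (hh₁.norm_le a t) (hh₀.norm_le a t)))
            (fun t t' ht => by
              simp only [Pi.sub_apply, hh₁.dependsOn a ht, hh₀.dependsOn a ht])).trans ?_
          have hprod : ∏ j ∈ a ∩ N.erase k, (Real.cos (θ j / 2))⁻¹ ≤
              ∏ j ∈ a, (Real.cos (θ j / 2))⁻¹ :=
            Finset.prod_le_prod_of_subset_of_one_le Finset.inter_subset_left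
              (fun j _ => (inv_pos.2 (cos_half_pos (hθ0 j) (hθ j))).le)
              (fun j _ _ => (one_le_inv₀ (cos_half_pos (hθ0 j) (hθ j))).2 (Real.cos_le_one _))
          rw [← two_mul, mul_assoc 2]
          have := hw0 a
          gcongr
        · have : ∀ t, h₁ a t - h₀ a t = 0 := fun t => sub_eq_zero.2 <| hh.dependsOn a fun i hi => by
            have : i ≠ k := by
              rintro rfl
              exact ha (Finset.mem_inter.1 hi).1
            simp [this]
          simp [this]
      have hd_eq : ∀ t, d t * Complex.exp (e t) =
          ∑ a, (h₁ a t - h₀ a t) * Complex.exp (e t) := fun t => by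
        rw [← Finset.sum_mul, Finset.sum_sub_distrib]
      change ‖∫ t, d t * Complex.exp (e t) ∂Measure.pi μ‖ ≤
        θ k * ‖∫ t, Complex.exp (e t) ∂Measure.pi μ‖
      simp_rw [hd_eq]
      have hint : ∀ a, Integrable (fun t => (h₁ a t - h₀ a t) * Complex.exp (e t))
          (Measure.pi μ) := fun a => integrable_mul_cexp
        ((hh₁.measurable a).sub (hh₀.measurable a)) hf.measurable_sum
        (fun t => (norm_sub_le _ _).trans (add_le_add (hh₁.norm_le a t) (hh₀.norm_le a t)))
        hf.norm_sum_le
      rw [integral_finsetSum _ fun a _ => hint a]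
      refine (norm_sum_le_of_le _ fun a _ => hbound a).trans ?_
      rw [← Finset.sum_mul, ← Finset.sum_filter, ← Finset.mul_sum]
      gcongr
      linarith)
  refine ⟨z, ?_, hzθ⟩
  simpa [d] using hz

theorem IsLocalFamily.hasMomentBound {μ : ∀ i, Measure (X i)} [∀ i, IsProbabilityMeasure (μ i)]
    (hθ0 : ∀ i, 0 ≤ θ i) (hθ : ∀ i, θ i < 2 * Real.pi / 3)
    (hw : ∀ k, ∑ a with k ∈ a, w a * ∏ j ∈ a, (Real.cos (θ j / 2))⁻¹ ≤ θ k / 2)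
    {N : Finset ι} {h : Finset ι → (∀ i, X i) → ℂ} (hh : IsLocalFamily w N h) :
    HasMomentBound μ θ N fun t => ∑ a, h a t := by
  induction N using Finset.strongInduction generalizing h with
  | H N IH =>
  intro K hK φ W hφ hφW hφK
  rcases K.eq_empty_or_nonempty with rfl | ⟨k, hk⟩
  · by_cases hX : Nonempty (∀ i, X i)
    · have hc : ∀ t, φ t = φ hX.some := fun t => hφK (by simp)
      simp_rw [hc _]
      rw [integral_const_mul, norm_mul, Finset.prod_empty, mul_one]
      gcongr
      exact hφW _
    · have : IsEmpty (∀ i, X i) := not_nonempty_iff.1 hX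
      simp [Measure.eq_zero_of_isEmpty]
  have hkN := hK hk
  have IH' := fun (h : Finset ι → (∀ i, X i) → ℂ) (hh : IsLocalFamily w (N.erase k) h) =>
    IH _ (Finset.erase_ssubset hkN) hh
  have hpres := measurePreserving_update μ k
  have hfub : ∀ {F : (∀ i, X i) → ℂ}, Integrable F (Measure.pi μ) →
      Integrable (fun s => ∫ t, F (Function.update t k s) ∂Measure.pi μ) (μ k) ∧
      ∫ t, F t ∂Measure.pi μ = ∫ s, ∫ t, F (Function.update t k s) ∂Measure.pi μ ∂μ k := by
    intro F hF
    have hF' := hpres.integrable_comp_of_integrable hF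
    refine ⟨hF'.integral_prod_left, ?_⟩
    have hmap := integral_map hpres.measurable.aemeasurable (hpres.map_eq.symm ▸ hF.1)
    rw [hpres.map_eq] at hmap
    exact hmap.trans (integral_prod _ hF')
  have hg := hh.measurable_sum
  obtain ⟨hi₁, he₁⟩ := hfub (integrable_mul_cexp hφ hg hφW hh.norm_sum_le)
  obtain ⟨hi₂, he₂⟩ := hfub (F := fun t => Complex.exp (∑ a, h a t)) (by
    simpa using integrable_mul_cexp (μ := Measure.pi μ) (φ := fun _ => 1) measurable_const hg
      (C := 1) (by simp) hh.norm_sum_le)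
  have hcos := cos_half_pos (hθ0 k) (hθ k)
  have hang := cos_mul_integral_norm_le_norm_integral hi₂ (hθ0 k) (hθ k) fun s s' => by
    obtain ⟨z, hz, hzθ⟩ := exists_integral_cexp_update_eq hθ0 hθ (hw k) IH' hh hkN s s'
    exact ⟨z, hz, (Complex.abs_im_le_norm z).trans hzθ⟩
  rw [he₁, he₂]
  set Q := ∏ j ∈ K.erase k, (Real.cos (θ j / 2))⁻¹
  have hQ : 0 ≤ Q := Finset.prod_nonneg fun j _ => (inv_pos.2 (cos_half_pos (hθ0 j) (hθ j))).le
  have hW : 0 ≤ W := by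
    have : Nonempty (∀ i, X i) := (Measure.pi μ).nonempty_of_neZero
    exact (norm_nonneg _).trans (hφW (Classical.arbitrary _))
  calc _ ≤ ∫ s, W * Q * ‖∫ t, Complex.exp (∑ a, h a (Function.update t k s)) ∂Measure.pi μ‖ ∂μ k :=
        norm_integral_le_of_norm_le (hi₂.norm.const_mul _) <| ae_of_all _ fun s =>
          IH' _ (hh.update k s) _ (Finset.erase_subset_erase k hK) _ W
            (measurable_comp_update hφ k s) (fun t => hφW _) (hφK.comp_update k s)
    _ = W * Q * ∫ s, ‖∫ t, Complex.exp (∑ a, h a (Function.update t k s)) ∂Measure.pi μ‖ ∂μ k :=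
        integral_const_mul _ _
    _ ≤ W * Q * ((Real.cos (θ k / 2))⁻¹ *
          ‖∫ s, ∫ t, Complex.exp (∑ a, h a (Function.update t k s)) ∂Measure.pi μ ∂μ k‖) := by
        gcongr
        rwa [le_inv_mul_iff₀ hcos]
    _ = _ := by
        rw [← Finset.mul_prod_erase _ _ hk]
        ring

/-- The main inequality for probability measures extends to finite measures by scaling. -/
theorem IsLocalFamily.prod_cos_mul_integral_norm_le {μ : ∀ i, Measure (X i)}
    [∀ i, IsFiniteMeasure (μ i)]
    (hθ0 : ∀ i, 0 ≤ θ i) (hθ : ∀ i, θ i < 2 * Real.pi / 3)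
    (hw : ∀ k, ∑ a with k ∈ a, w a * ∏ j ∈ a, (Real.cos (θ j / 2))⁻¹ ≤ θ k / 2)
    {h : Finset ι → (∀ i, X i) → ℂ} (hh : IsLocalFamily w Finset.univ h) :
    (∏ i, Real.cos (θ i / 2)) * ∫ t, ‖Complex.exp (∑ a, h a t)‖ ∂Measure.pi μ ≤
      ‖∫ t, Complex.exp (∑ a, h a t) ∂Measure.pi μ‖ := by
  by_cases h0 : ∃ i, μ i = 0
  · obtain ⟨i, hi⟩ := h0
    have : Measure.pi μ = 0 := by
      rw [← Measure.measure_univ_eq_zero, Measure.pi_univ]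
      exact Finset.prod_eq_zero (Finset.mem_univ i) (by simp [hi])
    simp [this]
  push Not at h0
  have hne : ∀ i, NeZero (μ i) := fun i => ⟨h0 i⟩
  set P : ∀ i, Measure (X i) := fun i => (μ i Set.univ)⁻¹ • μ i
  have hP : ∀ i, IsProbabilityMeasure (P i) := fun i => isProbabilityMeasureSMul
  have hpi : Measure.pi μ = (∏ i, μ i Set.univ) • Measure.pi P := by
    refine Measure.pi_eq fun s _ => ?_
    rw [Measure.smul_apply, Measure.pi_pi, smul_eq_mul, ← Finset.prod_mul_distrib]
    refine Finset.prod_congr rfl fun i _ => ?_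
    rw [Measure.smul_apply, smul_eq_mul, ← mul_assoc,
      ENNReal.mul_inv_cancel (by simp [h0 i]) (measure_ne_top _ _), one_mul]
  have H := (hh.hasMomentBound (μ := P) hθ0 hθ hw).integral_norm_le hh.measurable_sum
    hh.dependsOn_sum
  have hcos : 0 < ∏ i, Real.cos (θ i / 2) :=
    Finset.prod_pos fun i _ => cos_half_pos (hθ0 i) (hθ i)
  rw [Finset.prod_inv_distrib, le_inv_mul_iff₀ hcos] at H
  rw [hpi, integral_smul_measure, integral_smul_measure, norm_smul, smul_eq_mul,
    Real.norm_of_nonneg ENNReal.toReal_nonneg, mul_left_comm]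
  gcongr

end

section
variable {ι : Type*} [Fintype ι] [DecidableEq ι]

/-- The part of the power series with coefficients `c` that consists of the monomials with support
exactly `S`, with every variable truncated to `[-1, 1]`. -/
noncomputable def supportPart (c : (ι → ℕ) → ℂ) (S : Finset ι) (t : ι → ℝ) : ℂ :=
  ∑' a : ι → ℕ, if ({j | a j ≠ 0} : Finset ι) = S then
    c a * ∏ i, ((max (-1) (min (t i) 1) : ℝ) : ℂ) ^ a i else 0

/-- The sum of the moduli of the coefficients of the monomials with support exactly `S`. -/
noncomputable def supportWeight (c : (ι → ℕ) → ℂ) (S : Finset ι) : ℝ :=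
  ∑' a : ι → ℕ, if ({j | a j ≠ 0} : Finset ι) = S then ‖c a‖ else 0

variable {c : (ι → ℕ) → ℂ}

theorem summable_ite_support (hc : Summable fun a => ‖c a‖) (S : Finset ι) :
    Summable fun a : ι → ℕ => if ({j | a j ≠ 0} : Finset ι) = S then ‖c a‖ else 0 :=
  Summable.of_nonneg_of_le (fun a => by positivity) (fun a => by split_ifs <;> simp) hc

theorem norm_ite_support_le (c : (ι → ℕ) → ℂ) (S : Finset ι) (a : ι → ℕ) (t : ι → ℝ) :
    ‖if ({j | a j ≠ 0} : Finset ι) = S then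
      c a * ∏ i, ((max (-1) (min (t i) 1) : ℝ) : ℂ) ^ a i else 0‖ ≤
      if ({j | a j ≠ 0} : Finset ι) = S then ‖c a‖ else 0 := by
  split_ifs
  · rw [norm_mul, norm_prod]
    refine mul_le_of_le_one_right (norm_nonneg _) ?_
    refine Finset.prod_le_one (fun _ _ => norm_nonneg _) fun i _ => ?_
    rw [norm_pow, Complex.norm_real]
    refine pow_le_one₀ (norm_nonneg _) (abs_le.2 ⟨le_max_left _ _, ?_⟩)
    exact max_le (by norm_num) (min_le_right _ _)
  · simp

theorem isLocalFamily_supportPart (hc : Summable fun a => ‖c a‖) :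
    IsLocalFamily (X := fun _ : ι => ℝ) (supportWeight c) Finset.univ (supportPart c) where
  measurable S := by
    refine (continuous_tsum (fun a => ?_) (summable_ite_support hc S)
      fun a t => norm_ite_support_le c S a t).measurable
    split_ifs
    · fun_prop
    · fun_prop
  norm_le S t := tsum_of_norm_bounded (summable_ite_support hc S).hasSum
    fun a => norm_ite_support_le c S a t
  dependsOn S t t' ht := by
    refine tsum_congr fun a => ?_
    split_ifs with ha
    · congr 1
      refine Finset.prod_congr rfl fun i _ => ?_
      by_cases hi : a i = 0
      · simp [hi]
      · rw [ht i (by simp [← ha, hi])]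
    · rfl

theorem sum_supportPart (hc : Summable fun a => ‖c a‖) {t : ι → ℝ}
    (ht : ∀ i, t i ∈ Set.Icc (-1 : ℝ) 1) :
    ∑ S, supportPart c S t = ∑' a : ι → ℕ, c a * ∏ i, (t i : ℂ) ^ a i := by
  unfold supportPart
  rw [← Summable.tsum_finsetSum fun S _ => Summable.of_norm_bounded (summable_ite_support hc S)
    fun a => norm_ite_support_le c S a t]
  refine tsum_congr fun a => ?_
  rw [Finset.sum_ite_eq]
  simp [min_eq_left (ht _).2, max_eq_right (ht _).1]

theorem sum_supportWeight_mul (hc : Summable fun a => ‖c a‖) (q : Finset ι → ℝ) (i : ι) :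
    ∑ S with i ∈ S, supportWeight c S * q S =
      ∑' a : {a : ι → ℕ // a i ≠ 0}, ‖c a.1‖ * q {j | a.1 j ≠ 0} := by
  unfold supportWeight
  simp_rw [← tsum_mul_right]
  rw [← Summable.tsum_finsetSum fun S _ => (summable_ite_support hc S).mul_right _]
  refine Eq.trans (tsum_congr fun a => ?_)
    (tsum_subtype {a : ι → ℕ | a i ≠ 0} fun a => ‖c a‖ * q {j | a j ≠ 0}).symm
  simp_rw [ite_mul, zero_mul]
  rw [Finset.sum_ite_eq]
  simp [Set.indicator_apply]

end



theorem stmt_5 (m : ℕ) (ν : Fin m → Measure ℝ) [∀ i, IsFiniteMeasure (ν i)]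
    (c : (Fin m → ℕ) → ℂ) (hsum : Summable fun a => ‖c a‖)
    (θ : Fin m → ℝ) (hθ0 : ∀ i, 0 ≤ θ i) (hθ : ∀ i, θ i < 2 * Real.pi / 3)
    (hbound : ∀ i, ∑' a : {a : Fin m → ℕ // a i ≠ 0},
        ‖c a.1‖ * ∏ j ∈ Finset.univ.filter (fun j => a.1 j ≠ 0), (Real.cos (θ j / 2))⁻¹
        ≤ θ i / 2)
    (g : (Fin m → ℝ) → ℂ)
    (hg : ∀ t ∈ Set.pi Set.univ (fun _ : Fin m => Set.Icc (-1 : ℝ) 1),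
        g t = ∑' a : Fin m → ℕ, c a * ∏ i, (t i : ℂ) ^ a i) :
    ‖∫ t in Set.pi Set.univ (fun _ : Fin m => Set.Icc (-1 : ℝ) 1),
        Complex.exp (g t) ∂(Measure.pi ν)‖ ≥
      (∏ i, Real.cos (θ i / 2)) *
        ∫ t in Set.pi Set.univ (fun _ : Fin m => Set.Icc (-1 : ℝ) 1),
          ‖Complex.exp (g t)‖ ∂(Measure.pi ν) := by
  set box : Set (Fin m → ℝ) := Set.univ.pi fun _ => Set.Icc (-1 : ℝ) 1
  have hbox : MeasurableSet box := MeasurableSet.univ_pi fun _ => measurableSet_Icc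
  have hgt : ∀ t ∈ box, g t = ∑ S, supportPart c S t := fun t ht => by
    rw [hg t ht, sum_supportPart hsum fun i => ht i (Set.mem_univ i)]
  have key := (isLocalFamily_supportPart hsum).prod_cos_mul_integral_norm_le
    (μ := fun i => (ν i).restrict (Set.Icc (-1) 1)) hθ0 hθ fun k =>
      (sum_supportWeight_mul hsum (fun S => ∏ j ∈ S, (Real.cos (θ j / 2))⁻¹) k).trans_le (hbound k)
  rw [← Measure.restrict_pi_pi] at key
  rw [ge_iff_le, setIntegral_congr_fun hbox fun t ht => congrArg Complex.exp (hgt t ht),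
    setIntegral_congr_fun hbox fun t ht => congrArg (fun z => ‖Complex.exp z‖) (hgt t ht)]
  exact key
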